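/- Let V be a singular Minkowski space and let (x_k) be a sequence in V with ‖x_k‖ → ∞ and x_k/‖x_k‖ → v (so ‖v‖ = 1). Then for every y₀ ∈ V and every s ∈ ℝ, the differences of distances satisfy ‖x_k − (y₀ + s·v)‖ − ‖x_k − y₀‖ → −s as k → ∞. In particular, if the normalized distance functions d_{x_k} converge at a point y₀, then they converge at every point of the line through y₀ in direction v, and the limiting values decrease with unit slope along that line. -/

import Mathlib

open Filter

/-- Moving a point `z k` with `‖z k‖ → ∞` by `-s` times its limiting direction changes its norm
by `-s` asymptotically. -/
theorem tendsto_norm_sub_smul_sub_norm {ι V : Type*} [NormedAddCommGroup V] [NormedSpace ℝ V]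
    {l : Filter ι} {z : ι → V} {v : V}
    (hz : Tendsto (fun k => ‖z k‖) l atTop)
    (hdir : Tendsto (fun k => ‖z k‖⁻¹ • z k) l (nhds v)) (s : ℝ) :
    Tendsto (fun k => ‖z k - s • v‖ - ‖z k‖) l (nhds (-s)) := by
  have herr : Tendsto (fun k => ‖s • (‖z k‖⁻¹ • z k - v)‖) l (nhds 0) := by
    simpa using ((hdir.sub_const v).const_smul s).norm
  rw [tendsto_iff_norm_sub_tendsto_zero]
  refine squeeze_zero' (Eventually.of_forall fun _ => norm_nonneg _) ?_ herr
  filter_upwards [hz.eventually_gt_atTop 0, hz.eventually_ge_atTop s] with k hpos hs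
  have hradial : ‖z k - s • ‖z k‖⁻¹ • z k‖ = ‖z k‖ - s := by
    have hfactor : z k - s • ‖z k‖⁻¹ • z k = (1 - s * ‖z k‖⁻¹) • z k := by module
    have hnonneg : 0 ≤ 1 - s * ‖z k‖⁻¹ := by
      rw [← div_eq_mul_inv, sub_nonneg]
      exact (div_le_one hpos).2 hs
    rw [hfactor, norm_smul, Real.norm_of_nonneg hnonneg]
    field_simp
  calc ‖‖z k - s • v‖ - ‖z k‖ - -s‖
      = |‖z k - s • v‖ - ‖z k - s • ‖z k‖⁻¹ • z k‖| := by
        rw [hradial, Real.norm_eq_abs]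
        ring_nf
    _ ≤ ‖(z k - s • v) - (z k - s • ‖z k‖⁻¹ • z k)‖ := abs_norm_sub_norm_le _ _
    _ = ‖s • (‖z k‖⁻¹ • z k - v)‖ := by
        congr 1
        module

/-- The limiting direction of a sequence going to infinity is unchanged by a translation. -/
theorem tendsto_inv_norm_smul_sub_const {ι V : Type*} [NormedAddCommGroup V] [NormedSpace ℝ V]
    {l : Filter ι} {x : ι → V} {v : V}
    (hx : Tendsto (fun k => ‖x k‖) l atTop)
    (hdir : Tendsto (fun k => ‖x k‖⁻¹ • x k) l (nhds v)) (hv : ‖v‖ = 1) (y : V) :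
    Tendsto (fun k => ‖x k - y‖⁻¹ • (x k - y)) l (nhds v) := by
  have hscaled : Tendsto (fun k => ‖x k‖⁻¹ • (x k - y)) l (nhds v) := by
    simpa [smul_sub] using hdir.sub ((tendsto_inv_atTop_zero.comp hx).smul_const y)
  have hnormalized := (hscaled.norm.inv₀ (by simp [hv])).smul hscaled
  rw [hv, inv_one, one_smul] at hnormalized
  refine hnormalized.congr' ?_
  filter_upwards [hx.eventually_gt_atTop 0] with k hpos
  rw [norm_smul, norm_inv, norm_norm, smul_smul, mul_inv, inv_inv, mul_right_comm,
    mul_inv_cancel₀ hpos.ne', one_mul]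

/-- In a singular Minkowski space (finite-dimensional real normed space with strictly
convex norm), if `‖x_k‖ → ∞` and `x_k/‖x_k‖ → v`, then for every `y₀` and `s`,
`‖x_k - (y₀ + s • v)‖ - ‖x_k - y₀‖ → -s`. -/
theorem diff_dist_tendsto_along_direction {V : Type*} [NormedAddCommGroup V]
    [NormedSpace ℝ V] [FiniteDimensional ℝ V]
    (hsc : ∀ x y : V, ‖x‖ = 1 → ‖y‖ = 1 → x ≠ y → ‖(2 : ℝ)⁻¹ • (x + y)‖ < 1)
    (x : ℕ → V) (v : V)
    (hx : Tendsto (fun k => ‖x k‖) atTop atTop)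
    (hdir : Tendsto (fun k => (‖x k‖)⁻¹ • x k) atTop (nhds v))
    (hv : ‖v‖ = 1) :
    ∀ (y₀ : V) (s : ℝ),
      Tendsto (fun k => ‖x k - (y₀ + s • v)‖ - ‖x k - y₀‖) atTop (nhds (-s)) := by
  intro y₀ s
  have hz : Tendsto (fun k => ‖x k - y₀‖) atTop atTop :=
    tendsto_atTop_mono (fun k => norm_sub_norm_le (x k) y₀)
      (tendsto_atTop_add_const_right _ (-‖y₀‖) hx)
  simpa only [sub_sub] using
    tendsto_norm_sub_smul_sub_norm hz (tendsto_inv_norm_smul_sub_const hx hdir hv y₀) s
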